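/- Let p be a harmonic homogeneous polynomial of degree 4 in three real variables (Δp = 0), representing a harmonic fourth-order tensor H, and let d₂(p) be the symmetric 3×3 matrix with entries d₂(p)ᵢⱼ = Σ_{k,l,m} (∂ₖ∂ₗ∂ₘ∂ᵢ p)·(∂ₖ∂ₗ∂ₘ∂ⱼ p), realizing the covariant d₂ = tr₁₃(H²) up to a positive factor. Then H is cubic or isotropic — i.e. there exists h ∈ SO(3) such that every element of h𝕆h⁻¹ fixes p — if and only if the single polynomial relation 3·tr(d₂(p)²) = (tr d₂(p))² holds (i.e. 3 J₄ = J₂², where J₂ = tr d₂ and J₄ = tr d₂²). -/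

import Mathlib

open Matrix MvPolynomial

/-- The rotation group `SO(3)` as a set of real `3 × 3` matrices. -/
def SO3 : Set (Matrix (Fin 3) (Fin 3) ℝ) := {g | g * gᵀ = 1 ∧ g.det = 1}

/-- The octahedral subgroup `𝕆` of `SO(3)`: rotations sending each standard basis vector
to `±` a standard basis vector. -/
def Octa : Set (Matrix (Fin 3) (Fin 3) ℝ) :=
  {g | g ∈ SO3 ∧ ∀ i : Fin 3, ∃ j : Fin 3,
    g.mulVec (Pi.single i 1) = Pi.single j 1 ∨ g.mulVec (Pi.single i 1) = -Pi.single j 1}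

/-- The Laplacian of a polynomial in three variables. -/
noncomputable def lap (p : MvPolynomial (Fin 3) ℝ) : MvPolynomial (Fin 3) ℝ :=
  ∑ i, pderiv i (pderiv i p)

/-- `g ∈ SO(3)` fixes the polynomial `q`, i.e. `q(g⁻¹·x) = q(x)` for all `x`. -/
def fixesPoly (g : Matrix (Fin 3) (Fin 3) ℝ) (q : MvPolynomial (Fin 3) ℝ) : Prop :=
  ∀ x : Fin 3 → ℝ, eval (g⁻¹.mulVec x) q = eval x q

/-- The symmetric matrix `d₂(p)ᵢⱼ = Σ_{k,l,m} (∂ₖ∂ₗ∂ₘ∂ᵢ p)·(∂ₖ∂ₗ∂ₘ∂ⱼ p)`, realizing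
`d₂ = tr₁₃(H²)` up to a positive factor. -/
noncomputable def d2 (p : MvPolynomial (Fin 3) ℝ) : Matrix (Fin 3) (Fin 3) ℝ :=
  Matrix.of fun i j => ∑ k, ∑ l, ∑ m,
    (eval 0 (pderiv k (pderiv l (pderiv m (pderiv i p))))) *
    (eval 0 (pderiv k (pderiv l (pderiv m (pderiv j p)))))

lemma pderiv_comm (i j : Fin 3) (p : MvPolynomial (Fin 3) ℝ) :
    pderiv i (pderiv j p) = pderiv j (pderiv i p) := by
  ext m
  simp only [coeff_pderiv]
  by_cases h : i = j
  · subst h; rfl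
  · simp [h, Ne.symm h, add_right_comm m (Finsupp.single i 1)]
    ring

/-- Substitution of the linear map `h` into the polynomial `p`. -/
noncomputable def linSubst (h : Matrix (Fin 3) (Fin 3) ℝ) :
    MvPolynomial (Fin 3) ℝ →ₐ[ℝ] MvPolynomial (Fin 3) ℝ :=
  aeval fun a => ∑ i, C (h a i) * X i

lemma eval_linSubst (h : Matrix (Fin 3) (Fin 3) ℝ) (p : MvPolynomial (Fin 3) ℝ) (x : Fin 3 → ℝ) :
    eval x (linSubst h p) = eval (h *ᵥ x) p := by
  induction p using MvPolynomial.induction_on with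
  | C a => simp [linSubst]
  | add p q hp hq => simp [hp, hq]
  | mul_X p n hp =>
    have h1 : eval x (linSubst h (X n)) = (h *ᵥ x) n := by
      simp [linSubst, Matrix.mulVec, dotProduct]
    simp [hp, h1]

lemma isHomogeneous_linSubst (h : Matrix (Fin 3) (Fin 3) ℝ) {p : MvPolynomial (Fin 3) ℝ} {n : ℕ}
    (hp : p.IsHomogeneous n) : (linSubst h p).IsHomogeneous n := by
  have := hp.aeval (fun a => ∑ i, C (h a i) * X i) (n := 1)
    (fun a => IsHomogeneous.sum _ _ _ fun i _ => isHomogeneous_C_mul_X _ _)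
  simpa [linSubst] using this

lemma pderiv_linSubst (h : Matrix (Fin 3) (Fin 3) ℝ) (i : Fin 3) (p : MvPolynomial (Fin 3) ℝ) :
    pderiv i (linSubst h p) = ∑ a, h a i • linSubst h (pderiv a p) := by
  induction p using MvPolynomial.induction_on with
  | C a => simp [linSubst]
  | add p q hp hq => simp [hp, hq, Finset.sum_add_distrib]
  | mul_X p n hp =>
    have h1 : pderiv i (linSubst h (X n)) = C (h n i) := by
      simp [linSubst, Pi.single_apply]
    simp only [map_mul, pderiv_mul, hp, h1, map_add, smul_add, Finset.sum_add_distrib,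
      Finset.sum_mul, smul_mul_assoc, pderiv_X, Pi.single_apply]
    congr 1
    simp [MvPolynomial.smul_eq_C_mul, mul_comm]

lemma MvPolynomial.IsHomogeneous.eval_eq_sum_pderiv {p : MvPolynomial (Fin 3) ℝ} {n : ℕ}
    (hp : p.IsHomogeneous n) (x : Fin 3 → ℝ) :
    ∑ i, x i * eval x (pderiv i p) = n * eval x p := by
  have := congrArg (eval x) hp.sum_X_mul_pderiv
  simpa using this

lemma eval_eq_sum_pderiv_four {p : MvPolynomial (Fin 3) ℝ} (hp : p.IsHomogeneous 4)
    (x : Fin 3 → ℝ) : 24 * eval x p = ∑ i, x i * ∑ j, x j * ∑ k, x k * ∑ l, x l *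
      eval 0 (pderiv l (pderiv k (pderiv j (pderiv i p)))) := by
  have e0 {q : MvPolynomial (Fin 3) ℝ} (hq : q.IsHomogeneous 0) : eval 0 q = eval x q := by
    rw [← totalDegree_zero_iff_isHomogeneous, totalDegree_eq_zero_iff_eq_C] at hq
    rw [hq]; simp
  have h1 (i) : (pderiv i p).IsHomogeneous 3 := hp.pderiv
  have h2 (i j) : (pderiv j (pderiv i p)).IsHomogeneous 2 := (h1 i).pderiv
  have h3 (i j k) : (pderiv k (pderiv j (pderiv i p))).IsHomogeneous 1 := (h2 i j).pderiv
  have h4 (i j k l) : (pderiv l (pderiv k (pderiv j (pderiv i p)))).IsHomogeneous 0 :=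
    (h3 i j k).pderiv
  have f3 (i j k) : ∑ l, x l * eval 0 (pderiv l (pderiv k (pderiv j (pderiv i p)))) =
      eval x (pderiv k (pderiv j (pderiv i p))) := by
    simp_rw [e0 (h4 _ _ _ _)]
    simpa using (h3 i j k).eval_eq_sum_pderiv x
  have f2 (i j) := (h2 i j).eval_eq_sum_pderiv x
  have f1 (i) := (h1 i).eval_eq_sum_pderiv x
  have f0 := hp.eval_eq_sum_pderiv x
  simp_rw [f3, f2]
  simp only [Fin.sum_univ_three] at f1 f0 ⊢
  push_cast at f1 f0 ⊢
  linear_combination (-6) * f0 - 2 * x 0 * f1 0 - 2 * x 1 * f1 1 - 2 * x 2 * f1 2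

/-- The pairing of two polynomials through all of their `n`-th order derivatives at the origin. -/
noncomputable def derivPair :
    ℕ → MvPolynomial (Fin 3) ℝ →ₗ[ℝ] MvPolynomial (Fin 3) ℝ →ₗ[ℝ] ℝ
  | 0 => (LinearMap.mul ℝ ℝ).compl₁₂ (aeval 0).toLinearMap (aeval 0).toLinearMap
  | n + 1 => ∑ k, (derivPair n).compl₁₂ (pderiv k).toLinearMap (pderiv k).toLinearMap

lemma derivPair_zero (f g : MvPolynomial (Fin 3) ℝ) :
    derivPair 0 f g = eval 0 f * eval 0 g := by
  simp [derivPair]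

lemma derivPair_succ (n : ℕ) (f g : MvPolynomial (Fin 3) ℝ) :
    derivPair (n + 1) f g = ∑ k, derivPair n (pderiv k f) (pderiv k g) := by
  simp [derivPair, LinearMap.sum_apply]

lemma d2_apply (p : MvPolynomial (Fin 3) ℝ) (i j : Fin 3) :
    d2 p i j = derivPair 3 (pderiv i p) (pderiv j p) := by
  simp only [d2, of_apply, derivPair_succ, derivPair_zero, Fin.sum_univ_three]
  ring

lemma sum_mul_of_mul_transpose {h : Matrix (Fin 3) (Fin 3) ℝ} (hh : h * hᵀ = 1) (a b : Fin 3) :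
    h a 0 * h b 0 + h a 1 * h b 1 + h a 2 * h b 2 = (1 : Matrix (Fin 3) (Fin 3) ℝ) a b := by
  rw [← hh, Matrix.mul_apply, Fin.sum_univ_three]; rfl

lemma derivPair_linSubst {h : Matrix (Fin 3) (Fin 3) ℝ} (hh : h * hᵀ = 1) (n : ℕ)
    (f g : MvPolynomial (Fin 3) ℝ) :
    derivPair n (linSubst h f) (linSubst h g) = derivPair n f g := by
  induction n generalizing f g with
  | zero => rw [derivPair_zero, derivPair_zero, eval_linSubst, eval_linSubst, Matrix.mulVec_zero]
  | succ n ih =>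
    have H := sum_mul_of_mul_transpose hh
    have h00 := H 0 0
    have h01 := H 0 1
    have h02 := H 0 2
    have h11 := H 1 1
    have h12 := H 1 2
    have h22 := H 2 2
    simp only [Matrix.one_apply, Fin.isValue, Fin.reduceEq, if_true, if_false]
      at h00 h01 h02 h11 h12 h22
    simp only [derivPair_succ, pderiv_linSubst, Fin.sum_univ_three, map_add, map_smul,
      LinearMap.add_apply, LinearMap.smul_apply, ih, smul_eq_mul]
    generalize derivPair n = B
    linear_combination B (pderiv 0 f) (pderiv 0 g) * h00 + B (pderiv 1 f) (pderiv 1 g) * h11 +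
      B (pderiv 2 f) (pderiv 2 g) * h22 +
      (B (pderiv 0 f) (pderiv 1 g) + B (pderiv 1 f) (pderiv 0 g)) * h01 +
      (B (pderiv 0 f) (pderiv 2 g) + B (pderiv 2 f) (pderiv 0 g)) * h02 +
      (B (pderiv 1 f) (pderiv 2 g) + B (pderiv 2 f) (pderiv 1 g)) * h12

lemma d2_linSubst {h : Matrix (Fin 3) (Fin 3) ℝ} (hh : h * hᵀ = 1) (p : MvPolynomial (Fin 3) ℝ) :
    d2 (linSubst h p) = hᵀ * d2 p * h := by
  ext i j
  simp only [Matrix.mul_apply, d2_apply, pderiv_linSubst, map_add, LinearMap.add_apply, map_smul,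
    LinearMap.smul_apply, derivPair_linSubst hh, smul_eq_mul, Matrix.transpose_apply,
    Fin.sum_univ_three]
  ring

lemma lap_linSubst {h : Matrix (Fin 3) (Fin 3) ℝ} (hh : h * hᵀ = 1) (p : MvPolynomial (Fin 3) ℝ) :
    lap (linSubst h p) = linSubst h (lap p) := by
  have key (a b : Fin 3) :
      C (h a 0) * C (h b 0) + C (h a 1) * C (h b 1) + C (h a 2) * C (h b 2) =
        C (σ := Fin 3) ((1 : Matrix (Fin 3) (Fin 3) ℝ) a b) := by
    simp only [← C_mul, ← C_add, sum_mul_of_mul_transpose hh]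
  have h00 := key 0 0
  have h01 := key 0 1
  have h02 := key 0 2
  have h11 := key 1 1
  have h12 := key 1 2
  have h22 := key 2 2
  simp only [Matrix.one_apply, Fin.isValue, Fin.reduceEq, if_true, if_false, C_0, C_1]
    at h00 h01 h02 h11 h12 h22
  simp only [lap, pderiv_linSubst, Fin.sum_univ_three, map_add,
    MvPolynomial.smul_eq_C_mul, pderiv_C_mul]
  rw [pderiv_comm 1 0, pderiv_comm 2 0, pderiv_comm 2 1]
  linear_combination linSubst h (pderiv 0 (pderiv 0 p)) * h00 +
    linSubst h (pderiv 1 (pderiv 1 p)) * h11 + linSubst h (pderiv 2 (pderiv 2 p)) * h22 +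
    2 * linSubst h (pderiv 0 (pderiv 1 p)) * h01 + 2 * linSubst h (pderiv 0 (pderiv 2 p)) * h02 +
    2 * linSubst h (pderiv 1 (pderiv 2 p)) * h12

/-- Normal form of a harmonic quartic `q`, together with the equations expressing that `d2 q` is
scalar, when the first-order terms along the last axis vanish. -/
lemma exists_harmonic_coords {q : MvPolynomial (Fin 3) ℝ} (hq : q.IsHomogeneous 4)
    (hl : lap q = 0) : ∃ A b b' u v r s α β : ℝ,
    (∀ x y z : ℝ, 24 * eval ![x, y, z] q =
      A * (z ^ 4 - 3 * z ^ 2 * (x ^ 2 + y ^ 2) + 3 / 8 * (x ^ 2 + y ^ 2) ^ 2) +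
      4 * z ^ 3 * (b * x + b' * y) - 3 * z * (x ^ 2 + y ^ 2) * (b * x + b' * y) +
      (6 * z ^ 2 - (x ^ 2 + y ^ 2)) * (u * (x ^ 2 - y ^ 2) + 2 * v * x * y) +
      4 * z * (r * (x ^ 3 - 3 * x * y ^ 2) + s * (3 * x ^ 2 * y - y ^ 3)) +
      α * (x ^ 4 - 6 * x ^ 2 * y ^ 2 + y ^ 4) + 4 * β * (x ^ 3 * y - x * y ^ 3)) ∧
    (b = 0 → b' = 0 → ∀ c : ℝ, d2 q = c • (1 : Matrix (Fin 3) (Fin 3) ℝ) →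
      -15 / 4 * A * v - 2 * β * u + 2 * α * v = 0 ∧
      4 * α * r + 4 * β * s + 5 * r * u + 5 * s * v = 0 ∧
      4 * β * r - 4 * α * s + 5 * s * u - 5 * r * v = 0 ∧
      -15 / 2 * A * u - 4 * α * u - 4 * β * v = 0 ∧
      -25 / 8 * A ^ 2 - 4 * u ^ 2 + 8 * α ^ 2 + 8 * β ^ 2 - 4 * v ^ 2 + 4 * r ^ 2 + 4 * s ^ 2 = 0) := by
  obtain ⟨T, hT⟩ : ∃ T : Fin 3 → Fin 3 → Fin 3 → Fin 3 → ℝ, ∀ i j k l,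
      eval 0 (pderiv i (pderiv j (pderiv k (pderiv l q)))) = T i j k l := ⟨_, fun _ _ _ _ => rfl⟩
  have s1 (i j k l) : T i j k l = T j i k l := by rw [← hT, ← hT, pderiv_comm]
  have s2 (i j k l) : T i j k l = T i k j l := by rw [← hT, ← hT, pderiv_comm j k]
  have s3 (i j k l) : T i j k l = T i j l k := by rw [← hT, ← hT, pderiv_comm k l]
  have tr (i j) : T i j 0 0 + T i j 1 1 + T i j 2 2 = 0 := by
    have := congrArg (fun f => eval 0 (pderiv i (pderiv j f))) hl
    simpa only [lap, Fin.sum_univ_three, hT, map_add, map_zero] using this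
  have hd (i j) : d2 q i j = ∑ k, ∑ l, ∑ m, T k l m i * T k l m j := by
    simp only [d2, of_apply, hT]
  have hev (x : Fin 3 → ℝ) := eval_eq_sum_pderiv_four hq x
  simp only [hT, Fin.sum_univ_three] at hev
  simp only [s1, s2, s3] at hev
  have t00 := tr 0 0
  have t01 := tr 0 1
  have t02 := tr 0 2
  have t11 := tr 1 1
  have t12 := tr 1 2
  have t22 := tr 2 2
  simp only [s1, s2, s3] at t00 t01 t02 t11 t12 t22
  have e1 : T 1 1 2 2 = -T 0 0 2 2 - T 2 2 2 2 := by linarith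
  have e2 : T 0 0 0 0 = -T 0 0 1 1 - T 0 0 2 2 := by linarith
  have e3 : T 1 1 1 1 = -T 0 0 1 1 + T 0 0 2 2 + T 2 2 2 2 := by linarith
  have e4 : T 0 1 1 1 = -T 0 0 0 1 - T 0 1 2 2 := by linarith
  have e5 : T 0 1 1 2 = -T 0 0 0 2 - T 0 2 2 2 := by linarith
  have e6 : T 1 1 1 2 = -T 0 0 1 2 - T 1 2 2 2 := by linarith
  refine ⟨T 2 2 2 2, T 0 2 2 2, T 1 2 2 2, T 0 0 2 2 + T 2 2 2 2 / 2, T 0 1 2 2,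
    T 0 0 0 2 + 3 / 4 * T 0 2 2 2, T 0 0 1 2 + T 1 2 2 2 / 4, T 2 2 2 2 / 8 - T 0 0 1 1,
    T 0 0 0 1 + T 0 1 2 2 / 2, fun x y z => ?_, fun hb hb' c hc => ?_⟩
  · rw [hev]
    simp only [e1, e2, e3, e4, e5, e6, Matrix.cons_val]
    ring
  · have hdc (i j) : d2 q i j = c * (1 : Matrix (Fin 3) (Fin 3) ℝ) i j := by rw [hc]; rfl
    have d00 := hdc 0 0
    have d01 := hdc 0 1
    have d02 := hdc 0 2
    have d11 := hdc 1 1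
    have d12 := hdc 1 2
    have d22 := hdc 2 2
    simp only [hd, Fin.sum_univ_three, Matrix.one_apply, Fin.isValue, Fin.reduceEq, if_true, if_false]
      at d00 d01 d02 d11 d12 d22
    simp only [s1, s2, s3] at d00 d01 d02 d11 d12 d22
    simp only [e1, e2, e3, e4, e5, e6, hb, hb'] at d00 d01 d02 d11 d12 d22 ⊢
    refine ⟨?_, ?_, ?_, ?_, ?_⟩
    · linear_combination d01
    · linear_combination d02
    · linear_combination d12
    · linear_combination d00 - d11
    · linear_combination d00 + d11 - 2 * d22

lemma eq_zero_of_forall_mul_le {a k₂ k₃ k₄ : ℝ}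
    (H : ∀ t : ℝ, a * t ≤ k₂ * t ^ 2 + k₃ * t ^ 3 + k₄ * t ^ 4) : a = 0 := by
  have h1 : HasDerivAt (fun t : ℝ => k₂ * t ^ 2 + k₃ * t ^ 3 + k₄ * t ^ 4 - a * t) (-a) 0 := by
    have := ((((hasDerivAt_id (0 : ℝ)).pow 2).const_mul k₂).add
      (((hasDerivAt_id (0 : ℝ)).pow 3).const_mul k₃)).add
      (((hasDerivAt_id (0 : ℝ)).pow 4).const_mul k₄) |>.sub ((hasDerivAt_id (0 : ℝ)).const_mul a)
    convert! this using 1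
    simp
  have h2 : IsLocalMin (fun t : ℝ => k₂ * t ^ 2 + k₃ * t ^ 3 + k₄ * t ^ 4 - a * t) 0 :=
    Filter.Eventually.of_forall fun t => by simpa using H t
  simpa using h2.hasDerivAt_eq_zero h1

lemma eq_zero_and_eq_zero_of_sq_add_sq {a b : ℝ} (h : a ^ 2 + b ^ 2 = 0) : a = 0 ∧ b = 0 :=
  ⟨pow_eq_zero_iff two_ne_zero |>.1 (by linarith [sq_nonneg a, sq_nonneg b]),
    pow_eq_zero_iff two_ne_zero |>.1 (by linarith [sq_nonneg a, sq_nonneg b])⟩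

/-- If a harmonic quartic with scalar `d2` attains its maximal modulus on the sphere at the last
basis vector, then this vector is an axis of fourfold symmetry. -/
lemma exists_fourfold_form {q : MvPolynomial (Fin 3) ℝ} (hq : q.IsHomogeneous 4) (hl : lap q = 0)
    {c : ℝ} (hc : d2 q = c • (1 : Matrix (Fin 3) (Fin 3) ℝ))
    (hmax : ∀ x y z : ℝ,
      |eval ![x, y, z] q| ≤ eval ![0, 0, 1] q * (x ^ 2 + y ^ 2 + z ^ 2) ^ 2) :
    ∃ A α β : ℝ, 64 * (α ^ 2 + β ^ 2) = 25 * A ^ 2 ∧ ∀ x y z : ℝ, 24 * eval ![x, y, z] q =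
      A * (z ^ 4 - 3 * z ^ 2 * (x ^ 2 + y ^ 2) + 3 / 8 * (x ^ 2 + y ^ 2) ^ 2) +
      α * (x ^ 4 - 6 * x ^ 2 * y ^ 2 + y ^ 4) + 4 * β * (x ^ 3 * y - x * y ^ 3) := by
  obtain ⟨A, b, b', u, v, r, s, α, β, hev, heq⟩ := exists_harmonic_coords hq hl
  have hA : 24 * eval ![0, 0, 1] q = A := by rw [hev]; ring
  have hle (x y z : ℝ) : 24 * eval ![x, y, z] q ≤ A * (x ^ 2 + y ^ 2 + z ^ 2) ^ 2 := by
    have := (abs_le.1 (hmax x y z)).2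
    rw [← hA]; linarith
  have hge (x y z : ℝ) : -(A * (x ^ 2 + y ^ 2 + z ^ 2) ^ 2) ≤ 24 * eval ![x, y, z] q := by
    have := (abs_le.1 (hmax x y z)).1
    rw [← hA]; linarith
  simp only [hev] at hle hge
  have hb : b = 0 := by
    apply eq_zero_of_forall_mul_le (k₂ := (5 * A - 6 * u) / 4) (k₃ := 3 / 4 * b - r)
      (k₄ := (5 / 8 * A + u - α) / 4)
    intro t
    linarith [hle t 0 1]
  have hb' : b' = 0 := by
    apply eq_zero_of_forall_mul_le (k₂ := (5 * A + 6 * u) / 4) (k₃ := 3 / 4 * b' + s)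
      (k₄ := (5 / 8 * A - u - α) / 4)
    intro t
    linarith [hle 0 t 1]
  obtain ⟨q1, q2, q3, q4, q5⟩ := heq hb hb' c hc
  subst hb hb'
  have hA0 : 0 ≤ A := by linarith [hle 0 0 1, hge 0 0 1]
  have u1 : u ≤ 7 / 6 * A := by
    linarith [hle 1 0 1, hle (-1) 0 1, hge 1 0 0]
  have u2 : -(7 / 6 * A) ≤ u := by
    linarith [hle 0 1 1, hle 0 (-1) 1, hge 0 1 0]
  have v1 : v ≤ 3 / 2 * A := by
    linarith [hle 1 1 1, hle (-1) (-1) 1, hge 1 1 0]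
  have v2 : -(3 / 2 * A) ≤ v := by
    linarith [hle 1 (-1) 1, hle (-1) 1 1, hge 1 (-1) 0]
  have huv : u ^ 2 + v ^ 2 = 0 := by
    by_contra hne
    have k1 : (u ^ 2 + v ^ 2) * (225 * A ^ 2 - 64 * (α ^ 2 + β ^ 2)) = 0 := by
      linear_combination -8 * (15 / 2 * A * v - 4 * β * u + 4 * α * v) * q1 -
        4 * (15 / 2 * A * u - 4 * α * u - 4 * β * v) * q4
    have k2 := (mul_eq_zero.1 k1).resolve_left hne
    have hu := sq_le_sq' u2 u1
    have hv := sq_le_sq' v2 v1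
    exact hne (by linarith [sq_nonneg r, sq_nonneg s, sq_nonneg A, sq_nonneg u, sq_nonneg v])
  obtain ⟨hu, hv⟩ := eq_zero_and_eq_zero_of_sq_add_sq huv
  subst hu hv
  have hrs : r ^ 2 + s ^ 2 = 0 := by
    by_contra hne
    have k1 : (r ^ 2 + s ^ 2) * (α ^ 2 + β ^ 2) = 0 := by
      linear_combination (α * r + β * s) / 4 * q2 + (β * r - α * s) / 4 * q3
    have k2 := (mul_eq_zero.1 k1).resolve_left hne
    obtain ⟨hα, hβ⟩ := eq_zero_and_eq_zero_of_sq_add_sq k2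
    subst hα hβ
    have r1 : r ≤ 1 / 2 * A := by linarith [hge (-4) 0 3]
    have r2 : -(1 / 2 * A) ≤ r := by linarith [hge 4 0 3]
    have s1 : s ≤ 1 / 2 * A := by linarith [hge 0 4 3]
    have s2 : -(1 / 2 * A) ≤ s := by linarith [hge 0 (-4) 3]
    have hr := sq_le_sq' r2 r1
    have hs := sq_le_sq' s2 s1
    exact hne (by linarith [sq_nonneg A, sq_nonneg r, sq_nonneg s])
  obtain ⟨hr, hs⟩ := eq_zero_and_eq_zero_of_sq_add_sq hrs
  subst hr hs
  refine ⟨A, α, β, by linarith, fun x y z => ?_⟩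
  rw [hev]; ring

lemma exists_unit_rotation {A α β : ℝ} (h : 64 * (α ^ 2 + β ^ 2) = 25 * A ^ 2) :
    ∃ c s : ℝ, c ^ 2 + s ^ 2 = 1 ∧
      α * (c ^ 4 - 6 * c ^ 2 * s ^ 2 + s ^ 4) + 4 * β * (c ^ 3 * s - c * s ^ 3) = 5 / 8 * A ∧
      4 * α * (c ^ 3 * s - c * s ^ 3) - β * (c ^ 4 - 6 * c ^ 2 * s ^ 2 + s ^ 4) = 0 := by
  by_cases h0 : α ^ 2 + β ^ 2 = 0
  · obtain ⟨rfl, rfl⟩ := eq_zero_and_eq_zero_of_sq_add_sq h0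
    have : A = 0 := by
      rw [← sq_eq_zero_iff]; linarith
    exact ⟨1, 0, by norm_num, by simp [this], by simp⟩
  · have hz : (⟨α, -β⟩ : ℂ) ≠ 0 := by
      intro hz
      rw [Complex.ext_iff] at hz
      simp only [Complex.zero_re, Complex.zero_im, neg_eq_zero] at hz
      exact h0 (by rw [hz.1, hz.2]; norm_num)
    obtain ⟨w, hw⟩ := IsAlgClosed.exists_pow_nat_eq ((5 / 8 * A : ℝ) / (⟨α, -β⟩ : ℂ))
      (n := 4) (by norm_num)
    rw [eq_div_iff hz] at hw
    have hn : Complex.normSq w = 1 := by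
      have h1 := congrArg Complex.normSq hw
      have h3 : Complex.normSq (⟨α, -β⟩ : ℂ) = α ^ 2 + β ^ 2 := by rw [Complex.normSq_mk]; ring
      rw [map_mul, map_pow, Complex.normSq_ofReal, h3] at h1
      have h2 : Complex.normSq w ^ 4 = 1 := by
        apply mul_right_cancel₀ h0
        linear_combination h1 - 1 / 64 * h
      exact (pow_eq_one_iff_of_nonneg (Complex.normSq_nonneg w) (by norm_num)).1 h2
    obtain ⟨c, s⟩ := w
    rw [Complex.normSq_mk] at hn
    rw [Complex.ext_iff] at hw
    simp [pow_succ] at hw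
    exact ⟨c, s, by linear_combination hn, by linear_combination hw.1,
      by linear_combination hw.2⟩

/-- The harmonic quartic invariant under the octahedral group. -/
def cubicForm (x : Fin 3 → ℝ) : ℝ := 5 * ∑ i, x i ^ 4 - 3 * (x ⬝ᵥ x) ^ 2

lemma exists_rotation_eval_eq_cubicForm {q : MvPolynomial (Fin 3) ℝ} {A α β : ℝ}
    (h : 64 * (α ^ 2 + β ^ 2) = 25 * A ^ 2)
    (hev : ∀ x y z : ℝ, 24 * eval ![x, y, z] q =
      A * (z ^ 4 - 3 * z ^ 2 * (x ^ 2 + y ^ 2) + 3 / 8 * (x ^ 2 + y ^ 2) ^ 2) +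
      α * (x ^ 4 - 6 * x ^ 2 * y ^ 2 + y ^ 4) + 4 * β * (x ^ 3 * y - x * y ^ 3)) :
    ∃ g ∈ SO3, ∃ a : ℝ, ∀ x : Fin 3 → ℝ, eval (g *ᵥ x) q = a * cubicForm x := by
  obtain ⟨c, s, hcs, h1, h2⟩ := exists_unit_rotation h
  refine ⟨!![c, -s, 0; s, c, 0; 0, 0, 1], ⟨?_, ?_⟩, A / 48, fun x => ?_⟩
  · ext i j
    fin_cases i <;> fin_cases j <;> simp [Matrix.mul_apply, Fin.sum_univ_three] <;>
      linarith
  · rw [Matrix.det_fin_three]; simp; linarith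
  · have hx : !![c, -s, 0; s, c, 0; 0, 0, 1] *ᵥ x =
        ![c * x 0 - s * x 1, s * x 0 + c * x 1, x 2] := by
      ext i
      fin_cases i <;> simp [Matrix.mulVec, dotProduct, Fin.sum_univ_three]
      ring
    have hsq : (c * x 0 - s * x 1) ^ 2 + (s * x 0 + c * x 1) ^ 2 = x 0 ^ 2 + x 1 ^ 2 := by
      linear_combination (x 0 ^ 2 + x 1 ^ 2) * hcs
    rw [hx]
    have := hev (c * x 0 - s * x 1) (s * x 0 + c * x 1) (x 2)
    rw [hsq] at this
    simp only [cubicForm, dotProduct, Fin.sum_univ_three]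
    linear_combination this / 24 + (x 0 ^ 4 - 6 * x 0 ^ 2 * x 1 ^ 2 + x 1 ^ 4) / 24 * h1
      - (x 0 ^ 3 * x 1 - x 0 * x 1 ^ 3) / 6 * h2

lemma SO3.mul_mem {g h : Matrix (Fin 3) (Fin 3) ℝ} (hg : g ∈ SO3) (hh : h ∈ SO3) :
    g * h ∈ SO3 := by
  refine ⟨?_, by rw [Matrix.det_mul, hg.2, hh.2, one_mul]⟩
  rw [Matrix.transpose_mul, Matrix.mul_assoc, ← Matrix.mul_assoc h, hh.1, Matrix.one_mul, hg.1]

lemma SO3.transpose_mul {g : Matrix (Fin 3) (Fin 3) ℝ} (hg : g ∈ SO3) : gᵀ * g = 1 :=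
  mul_eq_one_comm.1 hg.1

lemma SO3.inv_eq {g : Matrix (Fin 3) (Fin 3) ℝ} (hg : g ∈ SO3) : g⁻¹ = gᵀ :=
  Matrix.inv_eq_right_inv hg.1

lemma SO3.dotProduct_mulVec {g : Matrix (Fin 3) (Fin 3) ℝ} (hg : g ∈ SO3) (x : Fin 3 → ℝ) :
    (g *ᵥ x) ⬝ᵥ (g *ᵥ x) = x ⬝ᵥ x := by
  rw [Matrix.dotProduct_mulVec, Matrix.vecMul_mulVec, SO3.transpose_mul hg, Matrix.vecMul_one]

lemma SO3.exists_mulVec_eq {v : Fin 3 → ℝ} (hv : v ⬝ᵥ v = 1) :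
    ∃ h ∈ SO3, h *ᵥ ![0, 0, 1] = v := by
  simp only [dotProduct, Fin.sum_univ_three] at hv
  obtain ⟨a, b, c, rfl⟩ : ∃ a b c, v = ![a, b, c] :=
    ⟨v 0, v 1, v 2, by ext i; fin_cases i <;> rfl⟩
  simp only [Matrix.cons_val] at hv
  by_cases hc : 1 + c = 0
  · obtain rfl : c = -1 := by linarith
    obtain ⟨rfl, rfl⟩ := eq_zero_and_eq_zero_of_sq_add_sq (a := a) (b := b) (by linarith)
    refine ⟨!![1, 0, 0; 0, -1, 0; 0, 0, -1], ⟨?_, ?_⟩, ?_⟩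
    · ext i j
      fin_cases i <;> fin_cases j <;> simp [Matrix.mul_apply, Fin.sum_univ_three]
    · rw [Matrix.det_fin_three]; simp
    · ext i
      fin_cases i <;> simp [Matrix.mulVec, dotProduct, Fin.sum_univ_three]
  · obtain ⟨k, hk⟩ : ∃ k, k * (1 + c) = 1 := ⟨(1 + c)⁻¹, inv_mul_cancel₀ hc⟩
    have hk2 : k * (a * a + b * b) = 1 - c := by linear_combination k * hv + (1 - c) * hk
    refine ⟨!![1 - k * a * a, -(k * a * b), a; -(k * a * b), 1 - k * b * b, b; -a, -b, c],
      ⟨?_, ?_⟩, ?_⟩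
    · ext i j
      fin_cases i <;> fin_cases j <;> simp [Matrix.mul_apply, Fin.sum_univ_three]
      · linear_combination a * a * k * hk2 - a * a * hk
      · linear_combination a * b * k * hk2 - a * b * hk
      · linear_combination a * hk2
      · linear_combination a * b * k * hk2 - a * b * hk
      · linear_combination b * b * k * hk2 - b * b * hk
      · linear_combination b * hk2
      · linear_combination a * hk2
      · linear_combination b * hk2
      · linear_combination hv
    · rw [Matrix.det_fin_three]; simp
      linear_combination hv - c * hk2
    · ext i
      fin_cases i <;> simp [Matrix.mulVec, dotProduct, Fin.sum_univ_three]

lemma eval_smul_of_isHomogeneous {p : MvPolynomial (Fin 3) ℝ} {n : ℕ} (hp : p.IsHomogeneous n)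
    (t : ℝ) (x : Fin 3 → ℝ) : eval (t • x) p = t ^ n * eval x p := by
  rw [eval_eq, eval_eq, Finset.mul_sum]
  refine Finset.sum_congr rfl fun d hd => ?_
  have h1 : ∑ i ∈ d.support, d i = n := (hp.degree_eq_sum_deg_support hd).symm
  simp only [Pi.smul_apply, smul_eq_mul, mul_pow, Finset.prod_mul_distrib,
    Finset.prod_pow_eq_pow_sum, h1]
  ring

lemma exists_abs_eval_le {p : MvPolynomial (Fin 3) ℝ} (hp : p.IsHomogeneous 4) :
    ∃ v : Fin 3 → ℝ, v ⬝ᵥ v = 1 ∧ ∀ x, |eval x p| ≤ |eval v p| * (x ⬝ᵥ x) ^ 2 := by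
  have hcont : Continuous fun x : Fin 3 → ℝ => x ⬝ᵥ x := by fun_prop
  have hK : IsCompact {x : Fin 3 → ℝ | x ⬝ᵥ x = 1} := by
    refine Metric.isCompact_of_isClosed_isBounded (isClosed_singleton.preimage hcont) ?_
    refine (Metric.isBounded_closedBall (x := (0 : Fin 3 → ℝ)) (r := 1)).subset fun x hx => ?_
    rw [mem_closedBall_zero_iff, pi_norm_le_iff_of_nonneg zero_le_one]
    intro i
    rw [Real.norm_eq_abs, ← sq_le_one_iff_abs_le_one, sq]
    have : x i * x i ≤ x ⬝ᵥ x :=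
      Finset.single_le_sum (f := fun i => x i * x i) (fun j _ => mul_self_nonneg _)
        (Finset.mem_univ i)
    exact this.trans_eq hx
  obtain ⟨v, hv, hmax⟩ := hK.exists_isMaxOn ⟨Pi.single 0 1, by simp⟩
    (f := fun x => |eval x p|) (MvPolynomial.continuous_eval p).abs.continuousOn
  refine ⟨v, hv, fun x => ?_⟩
  by_cases hx : x ⬝ᵥ x = 0
  · have : x = 0 := dotProduct_self_eq_zero.1 hx
    subst this
    have h0 : eval 0 p = 0 := by
      have := eval_smul_of_isHomogeneous hp 0 0
      rw [zero_smul] at this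
      rw [this]
      ring
    rw [h0, abs_zero]
    positivity
  · have hpos : 0 < x ⬝ᵥ x :=
      lt_of_le_of_ne (Finset.sum_nonneg fun i _ => mul_self_nonneg _) (Ne.symm hx)
    obtain ⟨t, ht⟩ : ∃ t, t = √(x ⬝ᵥ x) := ⟨_, rfl⟩
    have ht2 : t ^ 2 = x ⬝ᵥ x := by rw [ht, Real.sq_sqrt hpos.le]
    have ht0 : t ≠ 0 := by rintro rfl; simp at ht2; exact hx ht2.symm
    have h1 : (t⁻¹ • x) ⬝ᵥ (t⁻¹ • x) = 1 := by
      rw [smul_dotProduct, dotProduct_smul, ← ht2, smul_eq_mul, smul_eq_mul]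
      field_simp
    have h2 : |eval (t⁻¹ • x) p| ≤ |eval v p| := hmax h1
    have h3 : x = t • (t⁻¹ • x) := by rw [smul_smul, mul_inv_cancel₀ ht0, one_smul]
    rw [← ht2]
    conv_lhs => rw [h3, eval_smul_of_isHomogeneous hp, abs_mul, abs_pow]
    have h4 : |t| ^ 4 = (t ^ 2) ^ 2 := by rw [← sq_abs t]; ring
    rw [h4, mul_comm]
    gcongr

lemma three_mul_trace_mul_self_eq_iff {M : Matrix (Fin 3) (Fin 3) ℝ} (hM : Mᵀ = M) :
    3 * (M * M).trace = M.trace ^ 2 ↔ ∃ c : ℝ, M = c • 1 := by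
  constructor
  · intro h
    have h10 : M 1 0 = M 0 1 := congrFun (congrFun hM 0) 1
    have h20 : M 2 0 = M 0 2 := congrFun (congrFun hM 0) 2
    have h21 : M 2 1 = M 1 2 := congrFun (congrFun hM 1) 2
    simp only [Matrix.trace, Matrix.diag_apply, Matrix.mul_apply, Fin.sum_univ_three, h10, h20,
      h21] at h
    have h01 : M 0 1 = 0 := by
      rw [← sq_eq_zero_iff]
      nlinarith [sq_nonneg (M 0 1), sq_nonneg (M 0 2), sq_nonneg (M 1 2),
        sq_nonneg (M 0 0 - M 1 1), sq_nonneg (M 1 1 - M 2 2), sq_nonneg (M 2 2 - M 0 0)]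
    have h02 : M 0 2 = 0 := by
      rw [← sq_eq_zero_iff]
      nlinarith [sq_nonneg (M 0 1), sq_nonneg (M 0 2), sq_nonneg (M 1 2),
        sq_nonneg (M 0 0 - M 1 1), sq_nonneg (M 1 1 - M 2 2), sq_nonneg (M 2 2 - M 0 0)]
    have h12 : M 1 2 = 0 := by
      rw [← sq_eq_zero_iff]
      nlinarith [sq_nonneg (M 0 1), sq_nonneg (M 0 2), sq_nonneg (M 1 2),
        sq_nonneg (M 0 0 - M 1 1), sq_nonneg (M 1 1 - M 2 2), sq_nonneg (M 2 2 - M 0 0)]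
    rw [h01, h02, h12] at h
    obtain ⟨h11, h22⟩ := eq_zero_and_eq_zero_of_sq_add_sq
      (a := 2 * M 1 1 - M 0 0 - M 2 2) (b := M 0 0 - M 2 2)
      (by nlinarith [sq_nonneg (2 * M 1 1 - M 0 0 - M 2 2), sq_nonneg (M 0 0 - M 2 2)])
    refine ⟨M 0 0, ?_⟩
    ext i j
    fin_cases i <;> fin_cases j <;> simp [h10, h20, h21, h01, h02, h12] <;> linarith
  · rintro ⟨c, rfl⟩
    simp [Matrix.trace_smul]
    ring

lemma d2_transpose (p : MvPolynomial (Fin 3) ℝ) : (d2 p)ᵀ = d2 p := by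
  ext i j
  simp only [Matrix.transpose_apply, d2, Matrix.of_apply, mul_comm]

lemma d2_neg (p : MvPolynomial (Fin 3) ℝ) : d2 (-p) = d2 p := by
  simp only [d2, map_neg, neg_mul_neg]

lemma lap_neg (p : MvPolynomial (Fin 3) ℝ) : lap (-p) = -lap p := by
  simp only [lap, map_neg, Finset.sum_neg_distrib]

lemma cubicForm_transpose_mulVec {g : Matrix (Fin 3) (Fin 3) ℝ} (hg : g ∈ Octa)
    (x : Fin 3 → ℝ) : cubicForm (gᵀ *ᵥ x) = cubicForm x := by
  obtain ⟨hgS, hg⟩ := hg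
  choose j hj using hg
  have hcol (i : Fin 3) : (gᵀ *ᵥ x) i = (g *ᵥ Pi.single i 1) ⬝ᵥ x := by
    rw [Matrix.mulVec_single_one]
    rfl
  have hinv (i : Fin 3) : gᵀ *ᵥ (g *ᵥ Pi.single i 1) = Pi.single i 1 := by
    rw [Matrix.mulVec_mulVec, SO3.transpose_mul hgS, Matrix.one_mulVec]
  have hinj : Function.Injective j := by
    intro i k hik
    by_contra hne
    have hi := hinv i
    have hk := hinv k
    have hpm : (Pi.single i 1 : Fin 3 → ℝ) = Pi.single k 1 ∨
        (Pi.single i 1 : Fin 3 → ℝ) = -Pi.single k 1 := by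
      rcases hj i with h1 | h1 <;> rcases hj k with h2 | h2 <;> rw [h1] at hi <;>
        rw [h2] at hk <;> rw [← hi, ← hk, hik] <;> simp [Matrix.mulVec_neg]
    rcases hpm with h | h <;> simpa [hne] using congrFun h i
  have hsum : ∑ i, (gᵀ *ᵥ x) i ^ 4 = ∑ i, x i ^ 4 := by
    rw [← (Equiv.ofBijective j (Finite.injective_iff_bijective.1 hinj)).sum_comp
      fun i => x i ^ 4]
    refine Finset.sum_congr rfl fun i _ => ?_
    rw [hcol, Equiv.ofBijective_apply]
    rcases hj i with h | h <;> rw [h] <;> simp [Even.neg_pow (n := 4) ⟨2, rfl⟩]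
  have hnorm : (gᵀ *ᵥ x) ⬝ᵥ (gᵀ *ᵥ x) = x ⬝ᵥ x := by
    rw [Matrix.dotProduct_mulVec, Matrix.vecMul_mulVec, Matrix.transpose_transpose, hgS.1,
      Matrix.vecMul_one]
  rw [cubicForm, cubicForm, hsum, hnorm]

lemma fixesPoly_conj_iff {h g : Matrix (Fin 3) (Fin 3) ℝ} (hh : h ∈ SO3) (hg : g ∈ SO3)
    (p : MvPolynomial (Fin 3) ℝ) :
    fixesPoly (h * g * h⁻¹) p ↔ ∀ x, eval (h *ᵥ (gᵀ *ᵥ x)) p = eval (h *ᵥ x) p := by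
  have hinv : (h * g * h⁻¹)⁻¹ = h * gᵀ * hᵀ := by
    rw [SO3.inv_eq hh]
    refine Matrix.inv_eq_right_inv ?_
    simp only [Matrix.mul_assoc]
    rw [← Matrix.mul_assoc hᵀ h, SO3.transpose_mul hh, Matrix.one_mul, ← Matrix.mul_assoc g,
      hg.1, Matrix.one_mul, hh.1]
  rw [fixesPoly, hinv]
  constructor
  · intro H x
    simpa [Matrix.mulVec_mulVec, Matrix.mul_assoc, SO3.transpose_mul hh] using H (h *ᵥ x)
  · intro H x
    simpa [Matrix.mulVec_mulVec, Matrix.mul_assoc, hh.1] using H (hᵀ *ᵥ x)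

lemma exists_rotation_of_d2_eq_smul_one {p : MvPolynomial (Fin 3) ℝ} (hp : p.IsHomogeneous 4)
    (hharm : lap p = 0) {c : ℝ} (hc : d2 p = c • 1) :
    ∃ h ∈ SO3, ∃ a : ℝ, ∀ x : Fin 3 → ℝ, eval (h *ᵥ x) p = a * cubicForm x := by
  obtain ⟨v, hv, hmax⟩ := exists_abs_eval_le hp
  wlog hpos : 0 ≤ eval v p generalizing p
  · obtain ⟨h, hh, a, ha⟩ := this (p := -p) (by simpa using hp.neg)
      (by rw [lap_neg, hharm, neg_zero])
      (by rw [d2_neg, hc]) (by simpa using hmax) (by rw [map_neg]; linarith)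
    refine ⟨h, hh, -a, fun x => ?_⟩
    have := ha x
    rw [map_neg] at this
    linarith
  obtain ⟨h, hh, rfl⟩ := SO3.exists_mulVec_eq hv
  have hmax' (x y z : ℝ) : |eval ![x, y, z] (linSubst h p)| ≤
      eval ![0, 0, 1] (linSubst h p) * (x ^ 2 + y ^ 2 + z ^ 2) ^ 2 := by
    rw [eval_linSubst, eval_linSubst]
    refine (hmax _).trans_eq ?_
    rw [abs_of_nonneg hpos, SO3.dotProduct_mulVec hh]
    simp only [dotProduct, Fin.sum_univ_three, Matrix.cons_val]
    ring
  obtain ⟨A, α, β, h1, h2⟩ := exists_fourfold_form (c := c) (isHomogeneous_linSubst h hp)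
    (by rw [lap_linSubst hh.1, hharm, map_zero])
    (by rw [d2_linSubst hh.1, hc, Matrix.mul_smul, Matrix.smul_mul, Matrix.mul_one,
      SO3.transpose_mul hh]) hmax'
  obtain ⟨g, hg, a, ha⟩ := exists_rotation_eval_eq_cubicForm h1 h2
  refine ⟨h * g, SO3.mul_mem hh hg, a, fun x => ?_⟩
  rw [← ha, eval_linSubst, Matrix.mulVec_mulVec]

lemma halfTurn_zero_mem_octa : !![1, 0, 0; 0, -1, 0; 0, 0, -1] ∈ Octa := by
  refine ⟨⟨?_, by rw [Matrix.det_fin_three]; simp⟩, fun i => ⟨i, ?_⟩⟩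
  · ext i j
    fin_cases i <;> fin_cases j <;> simp [Matrix.mul_apply, Fin.sum_univ_three]
  · simp only [funext_iff, Fin.forall_fin_succ]
    fin_cases i <;> simp

lemma halfTurn_two_mem_octa : !![-1, 0, 0; 0, -1, 0; 0, 0, 1] ∈ Octa := by
  refine ⟨⟨?_, by rw [Matrix.det_fin_three]; simp⟩, fun i => ⟨i, ?_⟩⟩
  · ext i j
    fin_cases i <;> fin_cases j <;> simp [Matrix.mul_apply, Fin.sum_univ_three]
  · simp only [funext_iff, Fin.forall_fin_succ]
    fin_cases i <;> simp

lemma cyclicPerm_mem_octa : !![0, 0, 1; 1, 0, 0; 0, 1, 0] ∈ Octa := by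
  refine ⟨⟨?_, by rw [Matrix.det_fin_three]; simp⟩, fun i => ⟨i + 1, Or.inl ?_⟩⟩
  · ext i j
    fin_cases i <;> fin_cases j <;> simp [Matrix.mul_apply, Fin.sum_univ_three]
  · ext j
    fin_cases i <;> fin_cases j <;> simp

/-- A matrix commuting with the octahedral group is scalar. -/
lemma eq_smul_one_of_forall_octa {M : Matrix (Fin 3) (Fin 3) ℝ}
    (hM : ∀ g ∈ Octa, M * g = g * M) : ∃ c : ℝ, M = c • 1 := by
  have h0 := fun i j => congrFun (congrFun (hM _ halfTurn_zero_mem_octa) i) j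
  have h2 := fun i j => congrFun (congrFun (hM _ halfTurn_two_mem_octa) i) j
  have hs := fun i j => congrFun (congrFun (hM _ cyclicPerm_mem_octa) i) j
  simp only [Fin.forall_fin_succ, Matrix.mul_apply, Fin.sum_univ_three] at h0 h2 hs
  simp at h0 h2 hs
  refine ⟨M 0 0, ?_⟩
  ext i j
  fin_cases i <;> fin_cases j <;> simp <;> grind

/-- For a harmonic homogeneous degree-4 polynomial `p` representing a
harmonic fourth-order tensor `H`: `H` is cubic or isotropic (a conjugate of the octahedral
group fixes `p`) iff `3·tr(d₂(p)²) = (tr d₂(p))²`, i.e. `3 J₄ = J₂²`. -/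
theorem cubic_or_isotropic_iff_single_relation
    (p : MvPolynomial (Fin 3) ℝ) (hp : p.IsHomogeneous 4) (hharm : lap p = 0) :
    (∃ h ∈ SO3, ∀ g ∈ Octa, fixesPoly (h * g * h⁻¹) p) ↔
      3 * (d2 p * d2 p).trace = ((d2 p).trace) ^ 2 := by
  rw [three_mul_trace_mul_self_eq_iff (d2_transpose p)]
  constructor
  · rintro ⟨h, hh, hfix⟩
    obtain ⟨c, hc⟩ := eq_smul_one_of_forall_octa (M := d2 (linSubst h p)) fun g hg => by
      have hq : linSubst gᵀ (linSubst h p) = linSubst h p :=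
        MvPolynomial.funext fun x => by
          rw [eval_linSubst, eval_linSubst, eval_linSubst]
          exact (fixesPoly_conj_iff hh hg.1 p).1 (hfix g hg) x
      have hd := d2_linSubst (h := gᵀ) (by rw [transpose_transpose, SO3.transpose_mul hg.1])
        (linSubst h p)
      rw [hq, transpose_transpose] at hd
      conv_lhs => rw [hd, Matrix.mul_assoc, SO3.transpose_mul hg.1, Matrix.mul_one]
    refine ⟨c, ?_⟩
    rw [d2_linSubst hh.1] at hc
    have := congrArg (fun M => h * M * hᵀ) hc
    simpa [Matrix.mul_assoc, hh.1, ← Matrix.mul_assoc h hᵀ] using this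
  · rintro ⟨c, hc⟩
    obtain ⟨h, hh, a, ha⟩ := exists_rotation_of_d2_eq_smul_one hp hharm hc
    refine ⟨h, hh, fun g hg => (fixesPoly_conj_iff hh hg.1 p).2 fun x => ?_⟩
    rw [ha, ha, cubicForm_transpose_mulVec hg]
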